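/- ∫_0^1 ln(1+x)/x · ln(ln(1/x)) dx = (π²/12)(ln 2 − γ) + (1/2) ζ'(2). -/

import Mathlib

open MeasureTheory Real

/-- The Riemann zeta function as a real function, `ζ(s) = ∑_{n ≥ 1} n^{-s}`. -/
noncomputable def zetaR (s : ℝ) : ℝ := ∑' n : ℕ, ((n : ℝ) + 1) ^ (-s)

theorem integral_exp_neg_mul_log :
    ∫ t in Set.Ioi (0 : ℝ), exp (-t) * log t = -eulerMascheroniConstant := by
  have h : HasDerivAt Complex.GammaIntegral (-eulerMascheroniConstant : ℂ) 1 := by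
    refine Complex.hasDerivAt_Gamma_one.congr_of_eventuallyEq ?_
    have ho : IsOpen {s : ℂ | 0 < s.re} := isOpen_lt continuous_const Complex.continuous_re
    filter_upwards [ho.mem_nhds (show (1 : ℂ) ∈ {s : ℂ | 0 < s.re} by simp)] with s hs
    exact (Complex.Gamma_eq_integral hs).symm
  have key := (Complex.hasDerivAt_GammaIntegral (s := 1) (by simp)).unique h
  rw [← Complex.ofReal_inj, ← integral_complex_ofReal, Complex.ofReal_neg, ← key]
  refine setIntegral_congr_fun measurableSet_Ioi fun t _ => ?_
  simp [mul_comm]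

theorem integrableOn_exp_neg_mul_log :
    IntegrableOn (fun t => exp (-t) * log t) (Set.Ioi 0) := by
  by_contra h
  have h0 := integral_exp_neg_mul_log
  rw [integral_undef h] at h0
  linarith [one_half_lt_eulerMascheroniConstant]

theorem exp_neg_mul_mul_log_eq {a t : ℝ} (ha : 0 < a) (ht : 0 < t) :
    exp (-(a * t)) * log t = exp (-(a * t)) * log (a * t) - log a * exp (-(a * t)) := by
  rw [log_mul ha.ne' ht.ne']
  ring

theorem integrableOn_exp_neg_mul_mul_log {a : ℝ} (ha : 0 < a) :
    IntegrableOn (fun t => exp (-(a * t)) * log t) (Set.Ioi 0) := by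
  have h := (integrableOn_Ioi_comp_mul_left_iff
    (fun u => exp (-u) * log u - log a * exp (-u)) 0 ha).2 (by
      rw [mul_zero]
      exact integrableOn_exp_neg_mul_log.sub ((integrableOn_exp_neg_Ioi 0).const_mul _))
  exact h.congr_fun (fun t ht => (exp_neg_mul_mul_log_eq ha ht).symm) measurableSet_Ioi

theorem integral_exp_neg_mul_mul_log {a : ℝ} (ha : 0 < a) :
    ∫ t in Set.Ioi (0 : ℝ), exp (-(a * t)) * log t
      = -(eulerMascheroniConstant + log a) / a := by
  rw [setIntegral_congr_fun measurableSet_Ioi fun t ht => exp_neg_mul_mul_log_eq ha ht,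
    integral_comp_mul_left_Ioi (fun u => exp (-u) * log u - log a * exp (-u)) 0 ha, mul_zero,
    integral_sub integrableOn_exp_neg_mul_log ((integrableOn_exp_neg_Ioi 0).const_mul _),
    integral_exp_neg_mul_log, integral_const_mul, integral_exp_neg_Ioi_zero, smul_eq_mul]
  field_simp
  ring

theorem integral_norm_exp_neg_mul_mul_log_le {a : ℝ} (ha : 1 ≤ a) :
    ∫ t in Set.Ioi (0 : ℝ), ‖exp (-(a * t)) * log t‖
      ≤ ((∫ t in Set.Ioi (0 : ℝ), ‖exp (-t) * log t‖) + log a) / a := by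
  have ha0 : 0 < a := by linarith
  have hexp := (integrableOn_exp_neg_Ioi 0).const_mul (log a)
  have h : ∫ t in Set.Ioi (0 : ℝ), ‖exp (-(a * t)) * log t‖
      = a⁻¹ * ∫ u in Set.Ioi (0 : ℝ), ‖exp (-u) * log u - log a * exp (-u)‖ := by
    rw [setIntegral_congr_fun measurableSet_Ioi
        fun t ht => congrArg norm (exp_neg_mul_mul_log_eq ha0 ht),
      integral_comp_mul_left_Ioi (fun u => ‖exp (-u) * log u - log a * exp (-u)‖) 0 ha0,
      mul_zero, smul_eq_mul]
  rw [h, div_eq_inv_mul]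
  gcongr
  calc _ ≤ ∫ u in Set.Ioi (0 : ℝ), (‖exp (-u) * log u‖ + log a * exp (-u)) := by
        refine integral_mono (integrableOn_exp_neg_mul_log.sub hexp).norm
          (integrableOn_exp_neg_mul_log.norm.add hexp) fun u => ?_
        refine (norm_sub_le _ _).trans_eq ?_
        rw [Real.norm_of_nonneg (mul_nonneg (log_nonneg ha) (exp_pos _).le)]
    _ = _ := by
        rw [integral_add integrableOn_exp_neg_mul_log.norm hexp, integral_const_mul,
          integral_exp_neg_Ioi_zero, mul_one]

theorem summable_log_mul_rpow :
    Summable fun n : ℕ => log ((n : ℝ) + 1) * ((n : ℝ) + 1) ^ (-(3 / 2) : ℝ) := by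
  have h : Summable fun n : ℕ => 4 * ((n : ℝ) + 1) ^ (-(5 / 4) : ℝ) := by
    refine Summable.mul_left _ ?_
    exact_mod_cast (summable_nat_add_iff 1).2
      (Real.summable_nat_rpow.2 (by norm_num : (-(5 / 4) : ℝ) < -1))
  refine h.of_nonneg_of_le (fun n => ?_) fun n => ?_
  · have : (0 : ℝ) ≤ n := n.cast_nonneg
    exact mul_nonneg (log_nonneg (by linarith)) (by positivity)
  · have hn : (0 : ℝ) < n + 1 := by positivity
    have := Real.log_le_rpow_div hn.le (by norm_num : (0 : ℝ) < 1 / 4)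
    calc _ ≤ ((n : ℝ) + 1) ^ (1 / 4 : ℝ) / (1 / 4) * ((n : ℝ) + 1) ^ (-(3 / 2) : ℝ) := by gcongr
      _ = 4 * (((n : ℝ) + 1) ^ (1 / 4 : ℝ) * ((n : ℝ) + 1) ^ (-(3 / 2) : ℝ)) := by ring
      _ = _ := by rw [← rpow_add hn]; norm_num

theorem hasDerivAt_zetaR_two :
    HasDerivAt zetaR (-∑' n : ℕ, log ((n : ℝ) + 1) / ((n : ℝ) + 1) ^ 2) 2 := by
  have hd : HasDerivAt (fun s : ℝ => ∑' n : ℕ, ((n : ℝ) + 1) ^ (-s))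
      (∑' n : ℕ, -(log ((n : ℝ) + 1) * ((n : ℝ) + 1) ^ (-(2 : ℝ)))) 2 := by
    refine hasDerivAt_tsum_of_isPreconnected (y₀ := 2) (t := Set.Ioi (3 / 2))
      (g := fun (n : ℕ) (s : ℝ) => ((n : ℝ) + 1) ^ (-s))
      (g' := fun (n : ℕ) (s : ℝ) => -(log ((n : ℝ) + 1) * ((n : ℝ) + 1) ^ (-s)))
      summable_log_mul_rpow isOpen_Ioi isPreconnected_Ioi
      (fun n y _ => ?_) (fun n y hy => ?_) (by norm_num) ?_ (by norm_num)
    · have hn : (0 : ℝ) < n + 1 := by positivity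
      convert! (hasDerivAt_neg y).const_rpow hn using 1
      ring
    · have hn : (1 : ℝ) ≤ n + 1 := by linarith [(n.cast_nonneg : (0 : ℝ) ≤ n)]
      have hl := log_nonneg hn
      have hy' : (3 / 2 : ℝ) < y := hy
      rw [norm_neg, Real.norm_of_nonneg (by positivity)]
      gcongr
    · exact_mod_cast (summable_nat_add_iff 1).2
        (Real.summable_nat_rpow.2 (by norm_num : (-2 : ℝ) < -1))
  rw [← tsum_neg]
  convert! hd using 3 with n
  rw [rpow_neg (by positivity), ← div_eq_mul_inv]
  norm_num

theorem hasSum_one_div_nat_add_one_sq :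
    HasSum (fun n : ℕ => 1 / ((n : ℝ) + 1) ^ 2) (π ^ 2 / 6) := by
  have h := (hasSum_nat_add_iff' (f := fun n : ℕ => (1 : ℝ) / (n : ℝ) ^ 2) 1).2 hasSum_zeta_two
  simpa using h

theorem hasSum_log_div_sq :
    HasSum (fun n : ℕ => log ((n : ℝ) + 1) / ((n : ℝ) + 1) ^ 2) (-deriv zetaR 2) := by
  rw [hasDerivAt_zetaR_two.deriv, neg_neg]
  refine Summable.hasSum (summable_log_mul_rpow.of_nonneg_of_le (fun n => ?_) fun n => ?_)
  all_goals
    have hn : (1 : ℝ) ≤ n + 1 := by linarith [(n.cast_nonneg : (0 : ℝ) ≤ n)]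
    have hl := log_nonneg hn
  · positivity
  · rw [div_eq_mul_inv, ← rpow_natCast, ← rpow_neg (by positivity)]
    gcongr
    norm_num

/-- If `∑ f (n + 1) = a` and the even-indexed part `∑ f (2 (n + 1))` is `b`, the alternating sum
`∑ (-1) ^ n f (n + 1)` is `a - 2 b`. -/
theorem hasSum_alternating_of_hasSum_even {f : ℕ → ℝ} {a b : ℝ}
    (ha : HasSum (fun n => f (n + 1)) a) (hb : HasSum (fun n => f (2 * (n + 1))) b) :
    HasSum (fun n => (-1) ^ n * f (n + 1)) (a - 2 * b) := by
  let g : ℕ → ℝ := fun n => if Odd n then 2 * f (n + 1) else 0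
  have hg : HasSum g (2 * b) := by
    have h0 : HasSum (fun k => g (2 * k)) 0 := by
      refine hasSum_zero.congr_fun fun k => ?_
      simp [g]
    have h1 : HasSum (fun k => g (2 * k + 1)) (2 * b) := by
      refine (hb.mul_left 2).congr_fun fun k => ?_
      simp [g, mul_add]
    simpa using h0.even_add_odd h1
  refine (ha.sub hg).congr_fun fun n => ?_
  rcases n.even_or_odd with hn | hn
  · simp [g, hn.neg_one_pow, Nat.not_odd_iff_even.2 hn]
  · simp only [g, hn.neg_one_pow, if_pos hn]
    ring

theorem hasSum_alternating_const_add_log_div_sq (c : ℝ) :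
    HasSum (fun n : ℕ => (-1) ^ n * ((c + log ((n : ℝ) + 1)) / ((n : ℝ) + 1) ^ 2))
      (π ^ 2 / 12 * (c - log 2) - 1 / 2 * deriv zetaR 2) := by
  have h (d : ℝ) : HasSum (fun n : ℕ => (d + log ((n : ℝ) + 1)) / ((n : ℝ) + 1) ^ 2)
      (d * (π ^ 2 / 6) + -deriv zetaR 2) := by
    refine ((hasSum_one_div_nat_add_one_sq.mul_left d).add hasSum_log_div_sq).congr_fun
      fun n => ?_
    ring
  have key := hasSum_alternating_of_hasSum_even (f := fun n : ℕ => (c + log n) / (n : ℝ) ^ 2)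
    (a := c * (π ^ 2 / 6) + -deriv zetaR 2)
    (b := 1 / 4 * ((c + log 2) * (π ^ 2 / 6) + -deriv zetaR 2))
    (by simpa using h c)
    (((h (c + log 2)).mul_left (1 / 4)).congr_fun fun n => by
      push_cast
      rw [log_mul two_ne_zero (by positivity)]
      field_simp
      ring)
  convert! key using 1
  · simp
  · ring

theorem hasSum_log_one_add_exp_neg {t : ℝ} (ht : 0 < t) :
    HasSum (fun n : ℕ => (-1) ^ n / ((n : ℝ) + 1) * exp (-(((n : ℝ) + 1) * t)))
      (log (1 + exp (-t))) := by
  have hx : |-exp (-t)| < 1 := by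
    rw [abs_neg, abs_of_pos (exp_pos _), exp_lt_one_iff]
    linarith
  have h := (hasSum_pow_div_log_of_abs_lt_one hx).neg
  rw [neg_neg, sub_neg_eq_add] at h
  refine h.congr_fun fun n => ?_
  rw [neg_pow (exp (-t)), ← exp_nat_mul, pow_succ]
  push_cast
  rw [mul_neg]
  ring_nf

theorem integral_log_one_add_exp_neg_mul_log :
    ∫ t in Set.Ioi (0 : ℝ), log (1 + exp (-t)) * log t
      = π ^ 2 / 12 * (log 2 - eulerMascheroniConstant) + 1 / 2 * deriv zetaR 2 := by
  let F : ℕ → ℝ → ℝ := fun n t =>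
    (-1) ^ n / ((n : ℝ) + 1) * (exp (-(((n : ℝ) + 1) * t)) * log t)
  have hF (n : ℕ) : IntegrableOn (F n) (Set.Ioi 0) :=
    (integrableOn_exp_neg_mul_mul_log (by positivity)).const_mul _
  have hsum : Summable fun n => ∫ t in Set.Ioi (0 : ℝ), ‖F n t‖ := by
    set K := ∫ t in Set.Ioi (0 : ℝ), ‖exp (-t) * log t‖
    refine ((hasSum_one_div_nat_add_one_sq.mul_left K).add hasSum_log_div_sq).summable
      |>.of_nonneg_of_le (fun n => integral_nonneg fun t => norm_nonneg _) fun n => ?_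
    have hn : (1 : ℝ) ≤ n + 1 := by linarith [(n.cast_nonneg : (0 : ℝ) ≤ n)]
    have hnorm : ‖(-1 : ℝ) ^ n / ((n : ℝ) + 1)‖ = 1 / ((n : ℝ) + 1) := by
      rw [norm_div, norm_pow, norm_neg, norm_one, one_pow, Real.norm_of_nonneg (by positivity)]
    simp only [F, norm_mul _ (exp _ * _), integral_const_mul, hnorm]
    calc _ ≤ 1 / ((n : ℝ) + 1) * ((K + log ((n : ℝ) + 1)) / ((n : ℝ) + 1)) := by
          gcongr
          exact integral_norm_exp_neg_mul_mul_log_le hn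
      _ = _ := by
          field_simp
  have h1 := hasSum_integral_of_summable_integral_norm hF hsum
  have h2 : HasSum (fun n => ∫ t in Set.Ioi (0 : ℝ), F n t)
      (-(π ^ 2 / 12 * (eulerMascheroniConstant - log 2) - 1 / 2 * deriv zetaR 2)) := by
    refine (hasSum_alternating_const_add_log_div_sq eulerMascheroniConstant).neg.congr_fun
      fun n => ?_
    simp only [F]
    rw [integral_const_mul, integral_exp_neg_mul_mul_log (by positivity)]
    field_simp
  have h3 : ∫ t in Set.Ioi (0 : ℝ), ∑' n, F n t
      = ∫ t in Set.Ioi (0 : ℝ), log (1 + exp (-t)) * log t := by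
    refine setIntegral_congr_fun measurableSet_Ioi fun t ht => ?_
    simp only [F, ← mul_assoc]
    exact ((hasSum_log_one_add_exp_neg ht).mul_right _).tsum_eq
  rw [← h3, h1.unique h2]
  ring

theorem integral_Ioo_zero_one_eq_integral_exp_neg (g : ℝ → ℝ) :
    ∫ x in Set.Ioo (0 : ℝ) 1, g x = ∫ t in Set.Ioi (0 : ℝ), exp (-t) * g (exp (-t)) := by
  have himage : (fun t : ℝ => exp (-t)) '' Set.Ioi 0 = Set.Ioo 0 1 := by
    ext x
    constructor
    · rintro ⟨t, ht, rfl⟩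
      exact ⟨exp_pos _, exp_lt_one_iff.2 (neg_lt_zero.2 ht)⟩
    · rintro ⟨h0, h1⟩
      exact ⟨-log x, neg_pos.2 (log_neg h0 h1), by simp [exp_log h0]⟩
  rw [← himage, integral_image_eq_integral_abs_deriv_smul measurableSet_Ioi
    (fun t _ => ((hasDerivAt_neg t).exp).hasDerivWithinAt)
    (fun x _ y _ h => neg_injective (exp_injective h))]
  simp

theorem integral_log_one_add_div_mul_loglog :
    ∫ x in Set.Ioo (0 : ℝ) 1,
        Real.log (1 + x) / x * Real.log (Real.log (1 / x))
      = (Real.pi ^ 2 / 12) * (Real.log 2 - Real.eulerMascheroniConstant)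
        + (1 / 2) * deriv zetaR 2 := by
  rw [integral_Ioo_zero_one_eq_integral_exp_neg, ← integral_log_one_add_exp_neg_mul_log]
  congr 1 with t
  rw [one_div, ← exp_neg, neg_neg, log_exp, ← mul_assoc, mul_div_cancel₀ _ (exp_ne_zero _)]
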